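/- Let d ≥ 1, T ≥ 1, 0 < γ ≤ 1, α > 0. Let g_1, …, g_T ∈ ℝ^d and let (β_t) satisfy 1 − 1/t ≤ β_t ≤ 1 − γ/t for all t ≥ 1. Define v_{0,i} = 0 and v_{t,i} = β_t v_{t−1,i} + (1 − β_t) g_{t,i}² for each coordinate i. Let ε_t ∈ ℝ^d satisfy 0 < ε_{t,i} ≤ 1/t for all t, i, and t ε_{t,i} ≤ (t−1) ε_{t−1,i} for all t ≥ 2 and all i. Set α_t = α/t. Then ∑_{t=1}^T (α_t/2) ∑_{i=1}^d g_{t,i}² / (v_{t,i} + ε_{t,i}) ≤ (α/(2γ)) ∑_{i=1}^d log(T (v_{T,i} + ε_{T,i}) / ε_{1,i}) + (α/(2γ)) ∑_{t=2}^T ∑_{i=1}^d (−t ε_{t,i} + (t−1) ε_{t−1,i}) / (t v_{t,i} + t ε_{t,i}) + (α/(2γ)) ∑_{i=1}^d (1 − γ)(1 + log T) / min_{j ∈ {1,…,T}} (j v_{j,i} + j ε_{j,i}). -/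

import Mathlib

/-- An exponentially weighted running average of squares is non-negative. -/
theorem running_average_sq_nonneg {γ : ℝ} (hγ : 0 ≤ γ) {g β v : ℕ → ℝ}
    (hβ : ∀ t : ℕ, 1 ≤ t → 1 - 1 / (t : ℝ) ≤ β t ∧ β t ≤ 1 - γ / (t : ℝ))
    (hv0 : v 0 = 0)
    (hv : ∀ t : ℕ, 1 ≤ t → v t = β t * v (t - 1) + (1 - β t) * g t ^ 2) (t : ℕ) :
    0 ≤ v t := by
  induction t with
  | zero => exact hv0.ge
  | succ n ih =>
    obtain ⟨hlo, hhi⟩ := hβ (n + 1) n.succ_pos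
    have h0 : 0 ≤ β (n + 1) :=
      (sub_nonneg.2 (div_le_one_of_le₀ (by simp) (by positivity))).trans hlo
    have h1 : β (n + 1) ≤ 1 := hhi.trans (sub_le_self _ (by positivity))
    rw [hv (n + 1) n.succ_pos, Nat.add_sub_cancel]
    exact add_nonneg (mul_nonneg h0 ih) (mul_nonneg (sub_nonneg.2 h1) (sq_nonneg _))

/-- `(b - a) / b ≤ log b - log a` for positive reals. -/
theorem sub_div_le_log_sub_log {a b : ℝ} (ha : 0 < a) (hb : 0 < b) :
    (b - a) / b ≤ Real.log b - Real.log a := by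
  have h := Real.log_le_sub_one_of_pos (div_pos ha hb)
  rw [Real.log_div ha.ne' hb.ne'] at h
  rw [sub_div, div_self hb.ne']
  linarith

/-- One step of the running average `w = b u + (1 - b) x²`, in terms of the scaled averages
`t w` and `(t - 1) u`. -/
theorem sq_div_le_scaled_average_increment {γ t b u w x e : ℝ} (ht : 0 < t)
    (hb : 1 - 1 / t ≤ b) (hb' : b ≤ 1 - γ / t) (hu : 0 ≤ u)
    (hw : w = b * u + (1 - b) * x ^ 2) (hwe : 0 < w + e) :
    γ * (x ^ 2 / (w + e) / t) ≤ (t * w - (t - 1) * u) / (t * w + t * e) := by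
  have h1 : t - 1 ≤ t * b := by
    have := mul_le_mul_of_nonneg_left hb ht.le
    rwa [mul_sub, mul_one, mul_one_div_cancel ht.ne'] at this
  have h2 : γ ≤ t * (1 - b) := by
    have := mul_le_mul_of_nonneg_left hb' ht.le
    rw [mul_sub, mul_one, mul_div_cancel₀ _ ht.ne'] at this
    linarith
  have h3 : γ * (x ^ 2 / (w + e) / t) = γ * x ^ 2 / (t * w + t * e) := by
    rw [← mul_add, div_div, mul_div_assoc, mul_comm t]
  have hpos : 0 < t * w + t * e := by
    rw [← mul_add]
    exact mul_pos ht hwe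
  rw [h3]
  refine div_le_div_of_nonneg_right ?_ hpos.le
  have h4 := mul_le_mul_of_nonneg_right h1 hu
  have h5 := mul_le_mul_of_nonneg_right h2 (sq_nonneg x)
  have h6 : t * w = t * b * u + t * (1 - b) * x ^ 2 := by rw [hw]; ring
  linarith

/-- The single-coordinate logarithmic bound on the weighted sum of normalized squared gradients. -/
theorem sum_sq_div_running_average_le {γ : ℝ} (hγ0 : 0 < γ) {g β v ε : ℕ → ℝ}
    (hβ : ∀ t : ℕ, 1 ≤ t → 1 - 1 / (t : ℝ) ≤ β t ∧ β t ≤ 1 - γ / (t : ℝ))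
    (hv0 : v 0 = 0)
    (hv : ∀ t : ℕ, 1 ≤ t → v t = β t * v (t - 1) + (1 - β t) * g t ^ 2)
    (hε : ∀ t : ℕ, 1 ≤ t → 0 < ε t) {T : ℕ} (hT : 1 ≤ T) :
    γ * ∑ t ∈ Finset.Icc 1 T, g t ^ 2 / (v t + ε t) / (t : ℝ)
      ≤ Real.log ((T : ℝ) * (v T + ε T) / ε 1)
        + ∑ t ∈ Finset.Icc 2 T, (-((t : ℝ) * ε t) + ((t : ℝ) - 1) * ε (t - 1))
            / ((t : ℝ) * v t + (t : ℝ) * ε t) := by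
  have hv_nonneg : ∀ t, 0 ≤ v t := running_average_sq_nonneg hγ0.le hβ hv0 hv
  have hpos : ∀ t, 1 ≤ t → 0 < v t + ε t := fun t ht =>
    add_pos_of_nonneg_of_pos (hv_nonneg t) (hε t ht)
  have hstep : ∀ t : ℕ, 1 ≤ t → γ * (g t ^ 2 / (v t + ε t) / (t : ℝ))
      ≤ ((t : ℝ) * v t - ((t : ℝ) - 1) * v (t - 1)) / ((t : ℝ) * v t + (t : ℝ) * ε t) :=
    fun t ht => sq_div_le_scaled_average_increment (by exact_mod_cast ht) (hβ t ht).1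
      (hβ t ht).2 (hv_nonneg _) (hv t ht) (hpos t ht)
  induction T, hT using Nat.le_induction with
  | base =>
    have h := hstep 1 le_rfl
    have hlog := sub_div_le_log_sub_log (hε 1 le_rfl) (hpos 1 le_rfl)
    rw [← Real.log_div (hpos 1 le_rfl).ne' (hε 1 le_rfl).ne'] at hlog
    simp only [Nat.cast_one, one_mul, sub_self, zero_mul, sub_zero, add_sub_cancel_right]
      at h hlog
    simpa using h.trans hlog
  | succ n hn ih =>
    have hn0 : (0 : ℝ) < n := by exact_mod_cast hn
    have hS : 0 < (n : ℝ) * (v n + ε n) := mul_pos hn0 (hpos n hn)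
    have hS' : 0 < ((n + 1 : ℕ) : ℝ) * (v (n + 1) + ε (n + 1)) :=
      mul_pos (by positivity) (hpos _ n.succ_pos)
    have hlog := sub_div_le_log_sub_log hS hS'
    have h := hstep (n + 1) n.succ_pos
    rw [Finset.sum_Icc_succ_top (by omega), Finset.sum_Icc_succ_top (by omega), mul_add]
    rw [Real.log_div hS.ne' (hε 1 le_rfl).ne'] at ih
    rw [Real.log_div hS'.ne' (hε 1 le_rfl).ne']
    have hsplit : (((n + 1 : ℕ) : ℝ) * v (n + 1) - (((n + 1 : ℕ) : ℝ) - 1) * v (n + 1 - 1))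
          / (((n + 1 : ℕ) : ℝ) * v (n + 1) + ((n + 1 : ℕ) : ℝ) * ε (n + 1))
        = (((n + 1 : ℕ) : ℝ) * (v (n + 1) + ε (n + 1)) - (n : ℝ) * (v n + ε n))
            / (((n + 1 : ℕ) : ℝ) * (v (n + 1) + ε (n + 1)))
          + (-(((n + 1 : ℕ) : ℝ) * ε (n + 1)) + (((n + 1 : ℕ) : ℝ) - 1) * ε (n + 1 - 1))
            / (((n + 1 : ℕ) : ℝ) * v (n + 1) + ((n + 1 : ℕ) : ℝ) * ε (n + 1)) := by
      rw [← mul_add, ← add_div, Nat.add_sub_cancel]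
      congr 1
      push_cast
      ring
    linarith

/-- Lemma 10 in the paper: bound on `∑_{t=1}^T (α_t/2) ⟨g_t, A_t⁻¹ g_t⟩` for SC-RMSProp with
`A_t = diag(v_t + ε_t)` and step sizes `α_t = α/t`. -/
theorem sc_rmsprop_weighted_sum_bound
    (d T : ℕ) (hd : 1 ≤ d) (hT : 1 ≤ T)
    (γ α : ℝ) (hγ0 : 0 < γ) (hγ1 : γ ≤ 1) (hα : 0 < α)
    (g : ℕ → Fin d → ℝ) (β : ℕ → ℝ)
    (hβ : ∀ t : ℕ, 1 ≤ t → 1 - 1 / (t : ℝ) ≤ β t ∧ β t ≤ 1 - γ / (t : ℝ))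
    (v : ℕ → Fin d → ℝ) (hv0 : ∀ i, v 0 i = 0)
    (hv : ∀ t : ℕ, 1 ≤ t → ∀ i, v t i = β t * v (t - 1) i + (1 - β t) * g t i ^ 2)
    (ε : ℕ → Fin d → ℝ)
    (hε : ∀ t : ℕ, 1 ≤ t → ∀ i, 0 < ε t i ∧ ε t i ≤ 1 / (t : ℝ))
    (hεmono : ∀ t : ℕ, 2 ≤ t → ∀ i, (t : ℝ) * ε t i ≤ ((t : ℝ) - 1) * ε (t - 1) i) :
    ∑ t ∈ Finset.Icc 1 T, (α / (t : ℝ) / 2) * ∑ i, g t i ^ 2 / (v t i + ε t i)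
      ≤ (α / (2 * γ)) * ∑ i, Real.log ((T : ℝ) * (v T i + ε T i) / ε 1 i)
        + (α / (2 * γ)) * ∑ t ∈ Finset.Icc 2 T, ∑ i,
            (-((t : ℝ) * ε t i) + ((t : ℝ) - 1) * ε (t - 1) i)
              / ((t : ℝ) * v t i + (t : ℝ) * ε t i)
        + (α / (2 * γ)) * ∑ i,
            (1 - γ) * (1 + Real.log (T : ℝ))
              / ((Finset.Icc 1 T).inf' (Finset.nonempty_Icc.mpr hT)
                  (fun j => (j : ℝ) * v j i + (j : ℝ) * ε j i)) := by
  have hv_nonneg : ∀ t i, 0 ≤ v t i := fun t i =>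
    running_average_sq_nonneg (g := fun t => g t i) (v := fun t => v t i) hγ0.le hβ (hv0 i)
      (fun t ht => hv t ht i) t
  have hmin : 0 ≤ (α / (2 * γ)) * ∑ i, (1 - γ) * (1 + Real.log (T : ℝ))
      / ((Finset.Icc 1 T).inf' (Finset.nonempty_Icc.mpr hT)
          (fun j => (j : ℝ) * v j i + (j : ℝ) * ε j i)) := by
    refine mul_nonneg (by positivity) (Finset.sum_nonneg fun i _ => div_nonneg
      (mul_nonneg (sub_nonneg.2 hγ1) (add_nonneg zero_le_one (Real.log_natCast_nonneg T))) ?_)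
    refine Finset.le_inf' _ _ fun j hj => ?_
    have hεj := (hε j (Finset.mem_Icc.1 hj).1 i).1
    have hvj := hv_nonneg j i
    positivity
  have hcoord := Finset.sum_le_sum fun i (_ : i ∈ Finset.univ) =>
    sum_sq_div_running_average_le hγ0 (g := fun t => g t i) (v := fun t => v t i)
      (ε := fun t => ε t i) hβ (hv0 i) (fun t ht => hv t ht i) (fun t ht => (hε t ht i).1) hT
  have hlhs : ∑ t ∈ Finset.Icc 1 T, (α / (t : ℝ) / 2) * ∑ i, g t i ^ 2 / (v t i + ε t i)
      = (α / (2 * γ)) * ∑ i, γ * ∑ t ∈ Finset.Icc 1 T, g t i ^ 2 / (v t i + ε t i) / (t : ℝ) := by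
    rw [← Finset.mul_sum, Finset.sum_comm, ← mul_assoc, Finset.mul_sum]
    refine Finset.sum_congr rfl fun t _ => ?_
    rw [← Finset.sum_div]
    field_simp
  rw [Finset.sum_add_distrib, Finset.sum_comm (s := Finset.univ) (t := Finset.Icc 2 T)] at hcoord
  have hmain := mul_le_mul_of_nonneg_left hcoord (by positivity : 0 ≤ α / (2 * γ))
  rw [← hlhs, mul_add] at hmain
  exact hmain.trans (le_add_of_nonneg_right hmin)
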